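/- (Dedekind group determinant) Let G be a finite commutative group and let a : G → ℂ be any function. Consider the |G| × |G| matrix M indexed by pairs of elements of G whose (g,h) entry is a(g·h⁻¹). Then det M = ∏_χ ( Σ_{g∈G} a(g)·χ(g) ), where the product runs over all characters χ : G → ℂ×, i.e., all group homomorphisms from G to the units of ℂ. -/

import Mathlib

/-- **Dedekind group determinant.**
Let `G` be a finite commutative group and `a : G → ℂ`.  The determinant of the
`G`-circulant matrix `(a (g·h⁻¹))_{g,h}` equals the product, over all characters
`χ : G → ℂˣ`, of `Σ_{g ∈ G} a(g)·χ(g)`. -/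
theorem dedekind_group_determinant (G : Type*) [CommGroup G] [Fintype G]
    [DecidableEq G] [Fintype (G →* ℂˣ)] (a : G → ℂ) :
    (Matrix.of fun g h : G => a (g * h⁻¹)).det
      = ∏ χ : G →* ℂˣ, ∑ g : G, a g * (χ g : ℂ) := by
  have : NeZero (Monoid.exponent G) := ⟨Monoid.exponent_ne_zero_of_finite⟩
  obtain ⟨e'⟩ := CommGroup.monoidHom_mulEquiv_of_hasEnoughRootsOfUnity G ℂ
  let e : G ≃ (G →* ℂˣ) := e'.symm.toEquiv
  let P : Matrix G G ℂ := Matrix.of fun i g => ((e i g : ℂˣ) : ℂ)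
  let D : Matrix G G ℂ := Matrix.diagonal fun i => ∑ g : G, a g * ((e i g : ℂˣ) : ℂ)
  have hP : IsUnit P.det := by
    rw [← Matrix.isUnit_iff_isUnit_det, ← Matrix.linearIndependent_rows_iff_isUnit]
    refine (linearIndependent_monoidHom G ℂ).comp
      (fun i : G => (Units.coeHom ℂ).comp (e i)) ?_
    intro i j hij
    apply e.injective
    ext g
    exact DFunLike.congr_fun hij g
  have hPM : P * (Matrix.of fun g h : G => a (g * h⁻¹)) = D * P := by
    ext i h
    rw [Matrix.diagonal_mul, Matrix.mul_apply, Finset.sum_mul,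
      ← Equiv.sum_comp (Equiv.mulRight h)]
    refine Finset.sum_congr rfl fun g _ => ?_
    simp [P]
    ring
  have hdet := congrArg Matrix.det hPM
  rw [Matrix.det_mul, Matrix.det_mul, mul_comm D.det] at hdet
  rw [hP.mul_left_cancel hdet, Matrix.det_diagonal]
  exact Equiv.prod_comp e (fun χ : G →* ℂˣ => ∑ g : G, a g * (χ g : ℂ))
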